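/- arXiv:1608.02709 — 3 statements merged into one kernel-verified Lean document; each statement's English description precedes it below -/
import Mathlib

section
/- Let C = {(F_1^1,…,F_m^1;k^1),…,(F_1^q,…,F_m^q;k^q)} be the collection of instances obtained by the m-BR-process on (F_1,…,F_m;k), let S_B^p be the set of edges removed by Branching Rule 1 on the path from (F_1,…,F_m;k) to the p-th instance, let r and h be the minimum and maximum of the |S_B^p|, and let C_l be the set of resulting instances with |S_B^p| = l. If Branching Rule 1 is applied at least once during the m-BR-process, then: (i) k^p ≤ k − |S_B^p| for every p; (ii) Σ_{l=r}^{h} |C_l|/2^l = 1; and hence the m-BR-process satisfies the recurrence relation T(k) ≤ 2T(k−1), i.e., the unique positive root of the characteristic polynomial x^h − (|C_r|x^{h−r} + … + |C_{h−1}|x + |C_h|) of the recurrence T(k) ≤ |C_r|·T(k−r) + … + |C_h|·T(k−h) is at most 2. -/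
/-!
A formalization framework for the Maximum Agreement Forest problem on multiple
rooted multifurcating phylogenetic trees.

An `X`-forest is modeled (up to forced contraction and label-preserving
isomorphism) by the laminar family of the label-sets `L(v)` of its vertices:
every vertex `v` is identified with the set `L(v)` of labels at its leaf
descendants, components correspond to the maximal clusters, leaves to the
singleton clusters, and the edge between a non-root vertex `v` and its parent
is identified with the cluster `L(v)`.
-/

open Finset

noncomputable section
open scoped Classical

/-- A rooted multifurcating phylogenetic `X`-forest, described by the laminar
family of the label sets of its vertices. -/
structure XForest (X : Type*) where
  clusters : Finset (Finset X)
  nonempty_of_mem : ∀ s ∈ clusters, s.Nonempty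
  laminar : ∀ s ∈ clusters, ∀ t ∈ clusters, ¬Disjoint s t → s ⊆ t ∨ t ⊆ s
  singleton_mem : ∀ x : X, {x} ∈ clusters

namespace XForest

variable {X : Type*} [DecidableEq X] [Fintype X]

/-- The connected components of an `X`-forest: the maximal clusters.  The
component `C` is identified with its label set `L(C)`. -/
def components (F : XForest X) : Finset (Finset X) :=
  F.clusters.filter fun s => ∀ t ∈ F.clusters, ¬s ⊂ t

/-- The order of an `X`-forest: its number of connected components. -/
def ord (F : XForest X) : ℕ := F.components.card

/-- `c` is (the cluster of) a child of (the vertex with cluster) `p`. -/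
def IsChild (F : XForest X) (c p : Finset X) : Prop :=
  c ∈ F.clusters ∧ p ∈ F.clusters ∧ c ⊂ p ∧ ∀ t ∈ F.clusters, c ⊂ t → ¬t ⊂ p

/-- The family obtained from the laminar family `A` by removing, for every
`d ∈ D`, the edge between the vertex with cluster `d` and its parent. -/
def cutFam (A D : Finset (Finset X)) : Finset (Finset X) :=
  (A.image fun s => s \ (D.filter fun d => d ⊂ s).biUnion id).filter fun s => s.Nonempty

/-- The `X`-forest obtained from `F` by removing the edges above the clusters
in `D` (followed by forced contraction). -/
def cut (F : XForest X) (D : Finset (Finset X)) : XForest X where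
  clusters := cutFam F.clusters (D.filter fun d => d ∈ F.clusters)
  nonempty_of_mem := fun s hs => (Finset.mem_filter.mp hs).2
  laminar := by
    intro s' hs' t' ht' hnd
    set D' : Finset (Finset X) := D.filter fun d => d ∈ F.clusters with hD'def
    have hD'sub : ∀ d ∈ D', d ∈ F.clusters := fun d hd => (Finset.mem_filter.mp hd).2
    obtain ⟨hs'm, -⟩ := Finset.mem_filter.mp hs'
    obtain ⟨s, hs, rfl⟩ := Finset.mem_image.mp hs'm
    obtain ⟨ht'm, -⟩ := Finset.mem_filter.mp ht'
    obtain ⟨t, ht, rfl⟩ := Finset.mem_image.mp ht'm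
    obtain ⟨x, hxs, hxt⟩ := Finset.not_disjoint_iff.mp hnd
    have key : ∀ u ∈ F.clusters, ∀ w ∈ F.clusters, u ⊆ w →
        ∀ z, z ∈ u \ (D'.filter fun d => d ⊂ u).biUnion id →
          z ∈ w \ (D'.filter fun d => d ⊂ w).biUnion id →
          u \ (D'.filter fun d => d ⊂ u).biUnion id ⊆
            w \ (D'.filter fun d => d ⊂ w).biUnion id := by
      intro u hu w hw huw z hzu hzw y hy
      rw [Finset.mem_sdiff] at hy hzu hzw ⊢
      refine ⟨huw hy.1, ?_⟩
      intro hyU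
      rw [Finset.mem_biUnion] at hyU
      obtain ⟨d, hd, hyd⟩ := hyU
      rw [Finset.mem_filter] at hd
      have hdF : d ∈ F.clusters := hD'sub d hd.1
      have hdw : d ⊂ w := hd.2
      have hlam := F.laminar d hdF u hu (Finset.not_disjoint_iff.mpr ⟨y, hyd, hy.1⟩)
      rcases hlam with hdu | hud
      · by_cases hde : d = u
        · exact hzw.2 (Finset.mem_biUnion.mpr
            ⟨d, Finset.mem_filter.mpr ⟨hd.1, hdw⟩, hde ▸ hzu.1⟩)
        · have hss : d ⊂ u := Finset.ssubset_iff_subset_ne.mpr ⟨hdu, hde⟩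
          exact hy.2 (Finset.mem_biUnion.mpr
            ⟨d, Finset.mem_filter.mpr ⟨hd.1, hss⟩, hyd⟩)
      · exact hzw.2 (Finset.mem_biUnion.mpr
          ⟨d, Finset.mem_filter.mpr ⟨hd.1, hdw⟩, hud hzu.1⟩)
    have hxs' : x ∈ s ∧ x ∈ t := by
      constructor
      · exact (Finset.mem_sdiff.mp hxs).1
      · exact (Finset.mem_sdiff.mp hxt).1
    rcases F.laminar s hs t ht (Finset.not_disjoint_iff.mpr ⟨x, hxs'.1, hxs'.2⟩) with hst | hts
    · exact Or.inl (key s hs t ht hst x hxs hxt)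
    · exact Or.inr (key t ht s hs hts x hxt hxs)
  singleton_mem := by
    intro x
    have hU : ((D.filter fun d => d ∈ F.clusters).filter fun d => d ⊂ ({x} : Finset X)) = ∅ := by
      rw [Finset.filter_eq_empty_iff]
      intro d hd hss
      have hne := F.nonempty_of_mem d (Finset.mem_filter.mp hd).2
      rw [Finset.ssubset_singleton_iff.mp hss] at hne
      exact Finset.not_nonempty_empty hne
    refine Finset.mem_filter.mpr ⟨?_, Finset.singleton_nonempty x⟩
    refine Finset.mem_image.mpr ⟨{x}, F.singleton_mem x, ?_⟩
    rw [hU]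
    simp

/-- `G` is a subforest of `F` (up to forced contraction and label-preserving
isomorphism): `G` is obtained from `F` by removing a set of edges. -/
def IsSubforest (G F : XForest X) : Prop :=
  ∃ D ⊆ F.clusters, G.clusters = (F.cut D).clusters

/-- The edge of `F` between the vertex with cluster `c` and its parent is *in*
the forest `G` (i.e. it lies on a path of `F` connecting two labels that belong
to a common connected component of `G`). -/
def EdgeUsed (F : XForest X) (c : Finset X) (G : XForest X) : Prop :=
  ∃ x ∈ c, ∃ y, y ∉ c ∧ (∃ C ∈ F.components, x ∈ C ∧ y ∈ C) ∧
    ∃ D ∈ G.components, x ∈ D ∧ y ∈ D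

/-- The least common ancestor of the two labels `a` and `b` in `F` (given as
its cluster, i.e. as the label set `L(lca_F(a,b))`). -/
def lca2 (F : XForest X) (a b : X) : Finset X :=
  (F.clusters.filter fun s => a ∈ s ∧ b ∈ s).inf id

/-- The least common ancestor of the labels of `S` in `F` (given as its
cluster). -/
def lcaS (F : XForest X) (S : Finset X) : Finset X :=
  (F.clusters.filter fun s => S ⊆ s).inf id

/-- `E^1_F(a,b)`: the edges of `F` that are not on the path `P` connecting the
labels `a` and `b` but are incident to internal vertices of this path other
than `lca_F(a,b)` (each edge is identified with the cluster of its lower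
endpoint). -/
def E1 (F : XForest X) (a b : X) : Finset (Finset X) :=
  F.clusters.filter fun d => ∃ c ∈ F.clusters, F.IsChild d c ∧ c ⊂ F.lca2 a b ∧
    ((a ∈ c ∧ c ≠ {a} ∧ a ∉ d) ∨ (b ∈ c ∧ c ≠ {b} ∧ b ∉ d))

/-- `E^2_F(a,b)`: the edges incident to `lca_F(a,b)` other than the two edges
on the path connecting `a` and `b` and the edge to the parent of the lca. -/
def E2 (F : XForest X) (a b : X) : Finset (Finset X) :=
  F.clusters.filter fun d => F.IsChild d (F.lca2 a b) ∧ a ∉ d ∧ b ∉ d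

/-- `E_F(a,b) = E^1_F(a,b) ∪ E^2_F(a,b)`. -/
def Eset (F : XForest X) (a b : X) : Finset (Finset X) := F.E1 a b ∪ F.E2 a b

/-- `E^O_F(S)`: the edges between `lca_F(S)` and its children that are not
labels in `S`. -/
def EO (F : XForest X) (S : Finset X) : Finset (Finset X) :=
  F.clusters.filter fun d => F.IsChild d (F.lcaS S) ∧ ∀ x ∈ S, d ≠ {x}

/-- `S` is a maximal sibling set (MSS) of `F`: the leaves with labels in `S`
have a common parent `p` whose children are exactly the labels in `S`
(equivalently, `S` itself is a cluster all of whose proper subclusters are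
singletons). -/
def IsMSS (F : XForest X) (S : Finset X) : Prop :=
  S ∈ F.clusters ∧ 2 ≤ S.card ∧ ∀ c ∈ F.clusters, c ⊂ S → c.card = 1

/-- the labels in `S` are (pairwise) siblings in `F`, i.e., they have a common
parent. -/
def Siblings (F : XForest X) (S : Finset X) : Prop :=
  ∃ p ∈ F.clusters, ∀ x ∈ S, F.IsChild {x} p

/-- An `X`-forest is binary if each of its non-leaf vertices has exactly two
children. -/
def IsBinary (F : XForest X) : Prop :=
  ∀ s ∈ F.clusters, 2 ≤ s.card → ∃ c₁ c₂ : Finset X, c₁ ≠ c₂ ∧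
    F.IsChild c₁ s ∧ F.IsChild c₂ s ∧ ∀ c, F.IsChild c s → c = c₁ ∨ c = c₂

/-- `B` is a resolution of `F`: `F` can be obtained from `B` by contracting
internal edges. -/
def IsResolution (B F : XForest X) : Prop :=
  F.clusters ⊆ B.clusters ∧ B.components = F.components

/-- `G` is a binary subforest of `F`: `G` is binary and is a subforest of some
binary resolution of `F`. -/
def IsBinarySubforest (G F : XForest X) : Prop :=
  G.IsBinary ∧ ∃ B : XForest X, B.IsBinary ∧ IsResolution B F ∧ IsSubforest G B

end XForest

variable {X : Type*} [DecidableEq X] [Fintype X] {m : ℕ}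

/-- A hard agreement forest for the `X`-forests `Fs`. -/
def IsHAF (Fs : Fin m → XForest X) (G : XForest X) : Prop :=
  ∀ i, XForest.IsSubforest G (Fs i)

/-- A hard maximum agreement forest (hMAF) for the `X`-forests `Fs`. -/
def IsHMAF (Fs : Fin m → XForest X) (G : XForest X) : Prop :=
  IsHAF Fs G ∧ ∀ G', IsHAF Fs G' → G.ord ≤ G'.ord

/-- A soft agreement forest for the `X`-forests `Fs`. -/
def IsSAF (Fs : Fin m → XForest X) (G : XForest X) : Prop :=
  ∀ i, XForest.IsBinarySubforest G (Fs i)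

/-- A soft maximum agreement forest (sMAF) for the `X`-forests `Fs`. -/
def IsSMAF (Fs : Fin m → XForest X) (G : XForest X) : Prop :=
  IsSAF Fs G ∧ ∀ G', IsSAF Fs G' → G.ord ≤ G'.ord

/-- An instance `(F_1, …, F_m; k)` of the (hard or soft) Maf problem. -/
structure Inst (X : Type*) (m : ℕ) where
  F : Fin m → XForest X
  k : ℤ

namespace Inst

/-- the largest order of an `X`-forest in the instance. -/
def ordMax (I : Inst X m) : ℕ := Finset.univ.sup fun i => (I.F i).ord

/-- a solution of an instance of the hMaf problem: a hard agreement forest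
whose order is at most `ordMax + k`. -/
def IsSolution (I : Inst X m) (G : XForest X) : Prop :=
  IsHAF I.F G ∧ (G.ord : ℤ) ≤ (I.ordMax : ℤ) + I.k

/-- a yes-instance of the hMaf problem. -/
def IsYes (I : Inst X m) : Prop := ∃ G, I.IsSolution G

/-- a solution of an instance of the sMaf problem. -/
def IsSSolution (I : Inst X m) (G : XForest X) : Prop :=
  IsSAF I.F G ∧ (G.ord : ℤ) ≤ (I.ordMax : ℤ) + I.k

/-- a yes-instance of the sMaf problem. -/
def IsSYes (I : Inst X m) : Prop := ∃ G, I.IsSSolution G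

/-- `S` is a minimum maximal sibling set of the instance `I`, lying in the
`i`-th forest. -/
def MinMSS (I : Inst X m) (i : Fin m) (S : Finset X) : Prop :=
  (I.F i).IsMSS S ∧ ∀ j : Fin m, ∀ S' : Finset X, (I.F j).IsMSS S' → S.card ≤ S'.card

end Inst

/-- the new value of the parameter after removing one edge from the `j`-th
forest (the maximum order `ordMax + k` stays invariant). -/
def cutk (I : Inst X m) (j : Fin m) : ℤ :=
  if (I.F j).ord = I.ordMax then I.k - 1 else I.k

/-- Reduction Rule 1 is applicable on `Fj` relative to `Fi`, at the vertex `v`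
of `Fj` (whose parent edge is to be removed): there is a subset
`{C_1, …, C_t}` (`t ≥ 1`) of the components of `Fi` and a component `C` of
`Fj` containing a non-root vertex `v` with
`L(v) = L(C) ∩ (L(C_1) ∪ … ∪ L(C_t))`. -/
def RR1App (Fi Fj : XForest X) (v : Finset X) : Prop :=
  ∃ 𝒞 ⊆ Fi.components, 𝒞.Nonempty ∧
    ∃ C ∈ Fj.components, v ∈ Fj.clusters ∧ v ⊆ C ∧ (∃ t ∈ Fj.clusters, v ⊂ t) ∧
      v = C ∩ 𝒞.biUnion id

/-- One application of Reduction Rule 1 to the instance `I`, producing `I'`. -/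
def RR1Step (I I' : Inst X m) : Prop :=
  ∃ i j, i ≠ j ∧ ∃ v, RR1App (I.F i) (I.F j) v ∧
    I' = ⟨Function.update I.F j ((I.F j).cut {v}), cutk I j⟩

/-- Reduction Rule 1 is applicable somewhere on the instance `I`. -/
def RR1Applicable (I : Inst X m) : Prop :=
  ∃ i j, i ≠ j ∧ ∃ v, RR1App (I.F i) (I.F j) v

/-- `I'` is obtained from `I` by applying Reduction Rule 1 repeatedly until it
is no longer applicable. -/
def RR1Exhaust (I I' : Inst X m) : Prop :=
  Relation.ReflTransGen RR1Step I I' ∧ ¬RR1Applicable I'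

/-- The situation of Case 1 (Branching Rule 1) for `Fj` relative to `Fi`:
there is a component `C` of `Fi` and a vertex `v` of `Fj` with two children
`c₁, c₂` such that `L(c₁) ⊆ L(C)` and `L(c₂) ∩ L(C) = ∅`. -/
def BR1AppCore (Fi Fj : XForest X) (v c₁ c₂ : Finset X) : Prop :=
  ∃ C ∈ Fi.components, Fj.IsChild c₁ v ∧ Fj.IsChild c₂ v ∧ c₁ ≠ c₂ ∧
    c₁ ⊆ C ∧ c₂ ∩ C = ∅

/-- An application of Branching Rule 1 to the instance `I` (on the forest with
index `j`, relative to the forest with index `i`), branching into the two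
instances `I₁` (removing `[v,c₁]`) and `I₂` (removing `[v,c₂]`). -/
def BR1Branch (I : Inst X m) (i j : Fin m) (v c₁ c₂ : Finset X)
    (I₁ I₂ : Inst X m) : Prop :=
  i ≠ j ∧ BR1AppCore (I.F i) (I.F j) v c₁ c₂ ∧
    I₁ = ⟨Function.update I.F j ((I.F j).cut {c₁}), cutk I j⟩ ∧
    I₂ = ⟨Function.update I.F j ((I.F j).cut {c₂}), cutk I j⟩

/-- two `X`-forests satisfy the label-set isomorphism property. -/
def LabelIso (F F' : XForest X) : Prop := F.components = F'.components

/-- an instance satisfies the label-set isomorphism property. -/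
def InstLabelIso (I : Inst X m) : Prop := ∀ i j, LabelIso (I.F i) (I.F j)

/-- One computation path of the 2-BR-process on the forests with indices `p`
and `q`: repeatedly apply Branching Rule 1 between these two forests (choosing
one of the two branches) followed by an exhaustive application of Reduction
Rule 1, until the two forests satisfy the label-set isomorphism property.  The
natural number records the number of edges removed by Branching Rule 1 along
the path. -/
inductive TwoBRPath {X : Type*} [DecidableEq X] [Fintype X] {m : ℕ} (p q : Fin m) :
    Inst X m → Inst X m → ℕ → Prop
  | done (I : Inst X m) (h : LabelIso (I.F p) (I.F q)) : TwoBRPath p q I I 0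
  | step {I I₁ I₂ J K I' : Inst X m} {n : ℕ} {i j : Fin m} {v c₁ c₂ : Finset X}
      (hij : (i = p ∧ j = q) ∨ (i = q ∧ j = p))
      (hbr : BR1Branch I i j v c₁ c₂ I₁ I₂)
      (hpick : J = I₁ ∨ J = I₂)
      (hex : RR1Exhaust J K)
      (hrest : TwoBRPath p q K I' n) : TwoBRPath p q I I' (n + 1)

/-- `s` and `t` are the indices of two forests with the first and the second
largest orders in `I`. -/
def FirstSecond (I : Inst X m) (s t : Fin m) : Prop :=
  s ≠ t ∧ (∀ i, (I.F i).ord ≤ (I.F s).ord) ∧ ∀ i, i ≠ s → (I.F i).ord ≤ (I.F t).ord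

/-- One computation path of Stage 2 of the m-BR-process: repeatedly apply the
2-BR-process to two forests with first and second largest orders not
satisfying the label-set isomorphism property, until the whole instance
satisfies the label-set isomorphism property. -/
inductive MBRAux {X : Type*} [DecidableEq X] [Fintype X] {m : ℕ} :
    Inst X m → Inst X m → ℕ → Prop
  | done (I : Inst X m) (h : InstLabelIso I) : MBRAux I I 0
  | step {I J I' : Inst X m} {a b : ℕ} {s t : Fin m}
      (hst : FirstSecond I s t) (hni : ¬LabelIso (I.F s) (I.F t))
      (h2 : TwoBRPath s t I J a) (hrest : MBRAux J I' b) : MBRAux I I' (a + b)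

/-- One computation path of the m-BR-process on the instance `I`, ending at
the instance `I'`, along which `n` edges are removed by Branching Rule 1. -/
def MBRPath (I I' : Inst X m) (n : ℕ) : Prop :=
  ∃ J, RR1Exhaust I J ∧ MBRAux J I' n

/-- The full branching tree of the 2-BR-process on the forests with indices
`p` and `q`, producing the collection (list) of resulting instances, each
together with the number of edges removed by Branching Rule 1 on its
computation path. -/
inductive TwoBRTree {X : Type*} [DecidableEq X] [Fintype X] {m : ℕ} (p q : Fin m) :
    Inst X m → List (Inst X m × ℕ) → Prop
  | done (I : Inst X m) (h : LabelIso (I.F p) (I.F q)) : TwoBRTree p q I [(I, 0)]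
  | step {I I₁ I₂ K₁ K₂ : Inst X m} {L₁ L₂ : List (Inst X m × ℕ)}
      {i j : Fin m} {v c₁ c₂ : Finset X}
      (hij : (i = p ∧ j = q) ∨ (i = q ∧ j = p))
      (hbr : BR1Branch I i j v c₁ c₂ I₁ I₂)
      (he₁ : RR1Exhaust I₁ K₁) (he₂ : RR1Exhaust I₂ K₂)
      (h₁ : TwoBRTree p q K₁ L₁) (h₂ : TwoBRTree p q K₂ L₂) :
      TwoBRTree p q I ((L₁ ++ L₂).map fun x => (x.1, x.2 + 1))

/-- One step of Stage 2 of the m-BR-process on a collection of instances: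
replace an instance, in which two forests of first and second largest orders
do not satisfy the label-set isomorphism property, by the collection produced
by the 2-BR-process on those two forests. -/
inductive CollStep {X : Type*} [DecidableEq X] [Fintype X] {m : ℕ} :
    List (Inst X m × ℕ) → List (Inst X m × ℕ) → Prop
  | step {I : Inst X m} {n : ℕ} {A B L : List (Inst X m × ℕ)} {s t : Fin m}
      (hst : FirstSecond I s t) (hni : ¬LabelIso (I.F s) (I.F t))
      (h : TwoBRTree s t I L) :
      CollStep (A ++ (I, n) :: B) (A ++ L.map (fun y => (y.1, y.2 + n)) ++ B)

/-- The m-BR-process on the instance `I` produces the collection `L` of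
instances (each recorded with the number of edges removed by Branching Rule 1
on the path leading to it): Stage 1 applies Reduction Rule 1 exhaustively, and
Stage 2 repeatedly applies the 2-BR-process until every instance of the
collection satisfies the label-set isomorphism property. -/
def MBRTree (I : Inst X m) (L : List (Inst X m × ℕ)) : Prop :=
  ∃ J, RR1Exhaust I J ∧ Relation.ReflTransGen CollStep [(J, 0)] L ∧
    ∀ x ∈ L, InstLabelIso x.1

/-- The 2-edge distance property of an instance. -/
def TwoEdgeDist (I : Inst X m) : Prop :=
  ∃ (G : Inst X m) (E : Fin m → Finset (Finset X)),
    InstLabelIso G ∧ G.k = I.k + 1 ∧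
    (∀ i, E i ⊆ (G.F i).clusters) ∧ (∀ i, (E i).card ≤ 1) ∧
    (∀ i, ∀ v ∈ E i, ∃ t ∈ (G.F i).clusters, v ⊂ t) ∧
    (∀ i, (I.F i).clusters = ((G.F i).cut (E i)).clusters) ∧
    ∃ i j : Fin m, i < j ∧ ∃ vi ∈ E i, ∃ vj ∈ E j, vi ≠ vj

/-- A branching step producing instances with parameters `ks` from an instance
with parameter `k` satisfies the recurrence relation
`T(k) ≤ c₁·T(k-1) + c₂·T(k-2)`:  for every nonnegative monotone `T` satisfying
the recurrence, the sum of the `T`-values of the produced parameters is at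
most `T k`. -/
def RecBound (k : ℤ) (ks : List ℤ) (c₁ c₂ : ℕ) : Prop :=
  ∀ T : ℤ → ℝ, (∀ x, 0 ≤ T x) → Monotone T →
    (∀ x : ℤ, (c₁ : ℝ) * T (x - 1) + (c₂ : ℝ) * T (x - 2) ≤ T x) →
    (ks.map T).sum ≤ T k

end


namespace MBR

open XForest

section forests
variable {X : Type*} [DecidableEq X] [Fintype X]

theorem exists_comp (F : XForest X) {s : Finset X} (hs : s ∈ F.clusters) :
    ∃ C ∈ F.components, s ⊆ C := by
  obtain ⟨C, hC, hmax⟩ := F.clusters.exists_le_maximal hs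
  refine ⟨C, ?_, hC⟩
  unfold XForest.components
  rw [Finset.mem_filter]
  refine ⟨hmax.1, fun t ht hlt => ?_⟩
  exact absurd (hmax.2 ht hlt.1) hlt.2

theorem comp_mem (F : XForest X) {C : Finset X} (hC : C ∈ F.components) : C ∈ F.clusters := by
  unfold XForest.components at hC
  exact (Finset.mem_filter.mp hC).1

theorem comp_max (F : XForest X) {C s : Finset X} (hC : C ∈ F.components)
    (hs : s ∈ F.clusters) (hCs : C ⊆ s) : C = s := by
  unfold XForest.components at hC
  by_contra hne
  exact (Finset.mem_filter.mp hC).2 s hs (Finset.ssubset_iff_subset_ne.mpr ⟨hCs, hne⟩)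

theorem comp_eq (F : XForest X) {C D : Finset X} {x : X} (hC : C ∈ F.components)
    (hD : D ∈ F.components) (hxC : x ∈ C) (hxD : x ∈ D) : C = D := by
  rcases F.laminar C (comp_mem F hC) D (comp_mem F hD)
    (Finset.not_disjoint_iff.mpr ⟨x, hxC, hxD⟩) with h | h
  · exact comp_max F hC (comp_mem F hD) h
  · exact (comp_max F hD (comp_mem F hC) h).symm

theorem exists_comp_pt (F : XForest X) (x : X) : ∃ C : F.components, x ∈ C.1 := by
  obtain ⟨C, hC, h⟩ := exists_comp F (F.singleton_mem x)
  exact ⟨⟨C, hC⟩, h (Finset.mem_singleton_self x)⟩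

noncomputable def proj (F : XForest X) (x : X) : F.components := (exists_comp_pt F x).choose

theorem mem_proj (F : XForest X) (x : X) : x ∈ (proj F x).1 := (exists_comp_pt F x).choose_spec

theorem proj_eq (F : XForest X) {x : X} (C : F.components) (h : x ∈ C.1) : proj F x = C :=
  Subtype.ext (comp_eq F (proj F x).2 C.2 (mem_proj F x) h)

theorem proj_surj (F : XForest X) : Function.Surjective (proj F) := by
  intro C
  obtain ⟨x, hx⟩ := F.nonempty_of_mem C.1 (comp_mem F C.2)
  exact ⟨x, proj_eq F C hx⟩

/-- functions constant on the components -/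
noncomputable def sub (F : XForest X) : Submodule ℚ (X → ℚ) :=
  LinearMap.range (LinearMap.funLeft ℚ ℚ (proj F))

theorem finrank_sub (F : XForest X) : Module.finrank ℚ (sub F) = F.ord := by
  unfold sub
  rw [LinearMap.finrank_range_of_inj (LinearMap.funLeft_injective_of_surjective _ _ _ (proj_surj F))]
  simp [XForest.ord]

theorem mem_sub (F : XForest X) (f : X → ℚ) :
    f ∈ sub F ↔ ∀ C ∈ F.components, ∀ x ∈ C, ∀ y ∈ C, f x = f y := by
  unfold sub
  rw [LinearMap.mem_range]
  constructor
  · rintro ⟨g, rfl⟩ C hC x hx y hy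
    simp only [LinearMap.funLeft_apply]
    rw [proj_eq F ⟨C, hC⟩ hx, proj_eq F ⟨C, hC⟩ hy]
  · intro h
    refine ⟨fun C => f (proj_surj F C).choose, ?_⟩
    funext x
    simp only [LinearMap.funLeft_apply]
    have := (proj_surj F (proj F x)).choose_spec
    refine h (proj F x).1 (proj F x).2 _ ?_ _ (mem_proj F x)
    exact (congrArg Subtype.val this) ▸ mem_proj F (proj_surj F (proj F x)).choose

theorem cut_mem (F : XForest X) {v : Finset X} (hv : v ∈ F.clusters) (s' : Finset X) :
    s' ∈ (F.cut {v}).clusters ↔ ∃ s ∈ F.clusters, (v ⊂ s ∧ s' = s \ v) ∨ (¬ v ⊂ s ∧ s' = s) := by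
  have h1 : (({v} : Finset (Finset X)).filter fun d => d ∈ F.clusters) = {v} := by
    ext d; simp only [Finset.mem_filter, Finset.mem_singleton]
    constructor
    · exact fun h => h.1
    · rintro rfl; exact ⟨rfl, hv⟩
  unfold XForest.cut XForest.cutFam
  simp only [Finset.mem_filter, Finset.mem_image]
  have h2 : ∀ s : Finset X,
      s \ ((({v} : Finset (Finset X)).filter fun d => d ∈ F.clusters).filter
        fun d => d ⊂ s).biUnion id = if v ⊂ s then s \ v else s := by
    intro s
    rw [h1, Finset.filter_singleton]
    split_ifs <;> simp
  constructor
  · rintro ⟨⟨s, hs, he⟩, -⟩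
    refine ⟨s, hs, ?_⟩
    have h3 := h2 s
    by_cases hvs : v ⊂ s
    · left; refine ⟨hvs, ?_⟩
      rw [if_pos hvs] at h3; rw [← h3, ← he]
    · right; refine ⟨hvs, ?_⟩
      rw [if_neg hvs] at h3; rw [← h3, ← he]
  · rintro ⟨s, hs, ⟨hvs, rfl⟩ | ⟨hvs, rfl⟩⟩
    · refine ⟨⟨s, hs, ?_⟩, ?_⟩
      · have h3 := h2 s
        rw [if_pos hvs] at h3; exact h3
      · exact Finset.sdiff_nonempty.mpr hvs.2
    · refine ⟨⟨s', hs, ?_⟩, F.nonempty_of_mem _ hs⟩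
      have h3 := h2 s'
      rw [if_neg hvs] at h3; exact h3

theorem sub_cut_le (F : XForest X) {v : Finset X} (hv : v ∈ F.clusters) :
    sub F ≤ sub (F.cut {v}) := by
  intro f hf
  rw [mem_sub] at hf ⊢
  intro C hC x hx y hy
  obtain ⟨s, hs, h⟩ := (cut_mem F hv C).mp (comp_mem _ hC)
  have hCs : C ⊆ s := by
    rcases h with ⟨-, rfl⟩ | ⟨-, rfl⟩
    · exact Finset.sdiff_subset
    · exact subset_rfl
  obtain ⟨D, hD, hsD⟩ := exists_comp F hs
  exact hf D hD x (hsD (hCs hx)) y (hsD (hCs hy))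

noncomputable def ind (v : Finset X) : X → ℚ := fun x => if x ∈ v then 1 else 0

theorem ind_mem (F : XForest X) {v : Finset X} (hv : v ∈ F.clusters) :
    ind v ∈ sub (F.cut {v}) := by
  rw [mem_sub]
  intro C hC x hx y hy
  obtain ⟨s, hs, h⟩ := (cut_mem F hv C).mp (comp_mem _ hC)
  unfold ind
  rcases h with ⟨-, rfl⟩ | ⟨hvs, rfl⟩
  · rw [if_neg (Finset.mem_sdiff.mp hx).2, if_neg (Finset.mem_sdiff.mp hy).2]
  · by_cases hd : Disjoint v C
    · rw [if_neg (fun h => Finset.disjoint_left.mp hd h hx),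
        if_neg (fun h => Finset.disjoint_left.mp hd h hy)]
    · have hCv : C ⊆ v := by
        rcases F.laminar v hv C hs hd with h | h
        · by_contra hh; exact hvs ⟨h, hh⟩
        · exact h
      rw [if_pos (hCv hx), if_pos (hCv hy)]

theorem ord_cut_le (F : XForest X) {v t : Finset X} (hv : v ∈ F.clusters)
    (ht : t ∈ F.clusters) (hvt : v ⊂ t) : (F.cut {v}).ord ≤ F.ord + 1 := by
  obtain ⟨D, hD, htD⟩ := exists_comp F ht
  have hvD : v ⊂ D := lt_of_lt_of_le hvt htD
  obtain ⟨z, hz⟩ := F.nonempty_of_mem v hv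
  have hDv : D \ v ∈ (F.cut {v}).clusters :=
    (cut_mem F hv _).mpr ⟨D, comp_mem F hD, Or.inl ⟨hvD, rfl⟩⟩
  have hvv : v ∈ (F.cut {v}).clusters :=
    (cut_mem F hv _).mpr ⟨v, hv, Or.inr ⟨fun h => h.2 subset_rfl, rfl⟩⟩
  have hsub : (F.cut {v}).components ⊆ insert v (insert (D \ v) (F.components.erase D)) := by
    intro C hC
    rw [Finset.mem_insert, Finset.mem_insert, Finset.mem_erase]
    obtain ⟨s, hs, h⟩ := (cut_mem F hv C).mp (comp_mem _ hC)
    obtain ⟨E, hE, hsE⟩ := exists_comp F hs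
    rcases h with ⟨hvs, rfl⟩ | ⟨hvs, rfl⟩
    · right; left
      have : E = D := comp_eq F hE hD (hsE (hvs.1 hz)) (hvD.1 hz)
      subst this
      exact comp_max _ hC hDv (Finset.sdiff_subset_sdiff hsE subset_rfl)
    · by_cases hd : Disjoint v C
      · by_cases hED : E = D
        · subst hED
          right; left
          refine comp_max _ hC hDv ?_
          intro x hx
          exact Finset.mem_sdiff.mpr ⟨hsE hx, fun h => Finset.disjoint_left.mp hd h hx⟩
        · right; right
          have hEE : E ∈ (F.cut {v}).clusters := by
            refine (cut_mem F hv _).mpr ⟨E, comp_mem F hE, Or.inr ⟨fun h => ?_, rfl⟩⟩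
            exact hED (comp_eq F hE hD (h.1 hz) (hvD.1 hz))
          have := comp_max _ hC hEE hsE
          rw [this]
          exact ⟨hED, hE⟩
      · left
        refine comp_max _ hC hvv ?_
        rcases F.laminar v hv C hs hd with h | h
        · by_contra hh; exact hvs ⟨h, hh⟩
        · exact h
  have h1 := Finset.card_le_card hsub
  have h2 := Finset.card_insert_le v (insert (D \ v) (F.components.erase D))
  have h3 := Finset.card_insert_le (D \ v) (F.components.erase D)
  have h4 := Finset.card_erase_add_one hD
  unfold XForest.ord
  omega

theorem ind_not_mem (F G : XForest X) {v t : Finset X} (hv : v ∈ F.clusters)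
    (ht : t ∈ F.clusters) (hvt : v ⊂ t) (hno : ¬ RR1App G F v) : ind v ∉ sub F ⊔ sub G := by
  intro hmem
  obtain ⟨f, hf, g, hg, hfg⟩ := Submodule.mem_sup.mp hmem
  rw [mem_sub] at hf hg
  obtain ⟨D, hD, htD⟩ := exists_comp F ht
  obtain ⟨z, hz⟩ := F.nonempty_of_mem v hv
  have hzD : z ∈ D := htD (hvt.1 hz)
  have hval : ∀ x, f x + g x = if x ∈ v then 1 else 0 := fun x => congrFun hfg x
  apply hno
  classical
  refine ⟨G.components.filter (fun C => ∃ x ∈ C, g x = g z), Finset.filter_subset _ _, ?_,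
    D, hD, hv, hvt.1.trans htD, ⟨t, ht, hvt⟩, ?_⟩
  · obtain ⟨C, hC⟩ := exists_comp_pt G z
    exact ⟨C.1, Finset.mem_filter.mpr ⟨C.2, z, hC, rfl⟩⟩
  · have hzv := hval z
    rw [if_pos hz] at hzv
    ext x
    rw [Finset.mem_inter, Finset.mem_biUnion]
    constructor
    · intro hx
      have hxD : x ∈ D := htD (hvt.1 hx)
      refine ⟨hxD, ?_⟩
      obtain ⟨C, hC⟩ := exists_comp_pt G x
      refine ⟨C.1, Finset.mem_filter.mpr ⟨C.2, x, hC, ?_⟩, hC⟩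
      have h1 := hval x
      rw [if_pos hx] at h1
      have h2 := hf D hD x hxD z hzD
      linarith
    · rintro ⟨hxD, C, hC, hxC⟩
      obtain ⟨hC, y, hy, hyz⟩ := Finset.mem_filter.mp hC
      have h1 := hval x
      have h2 := hf D hD x hxD z hzD
      have h3 := hg C hC x hxC y hy
      by_contra hx
      rw [if_neg hx] at h1
      linarith

noncomputable def phi (F G : XForest X) : ℕ := Module.finrank ℚ (sub F ⊔ sub G : Submodule ℚ (X → ℚ))

theorem phi_comm (F G : XForest X) : phi F G = phi G F := by
  unfold phi; rw [sup_comm]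

theorem phi_mono {F F' G G' : XForest X} (h : sub F ≤ sub F') (h' : sub G ≤ sub G') :
    phi F G ≤ phi F' G' := Submodule.finrank_mono (sup_le_sup h h')

theorem ord_le_phi (F G : XForest X) : F.ord ≤ phi F G := by
  rw [← finrank_sub]; exact Submodule.finrank_mono le_sup_left

theorem phi_iso {F G : XForest X} (h : LabelIso F G) : phi F G = F.ord := by
  have : sub F = sub G := by
    ext f; rw [mem_sub, mem_sub, show F.components = G.components from h]
  unfold phi
  rw [← this, sup_idem, finrank_sub]

theorem phi_cut (F G : XForest X) {v t : Finset X} (hv : v ∈ F.clusters)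
    (ht : t ∈ F.clusters) (hvt : v ⊂ t) (hno : ¬ RR1App G F v) :
    phi F G + 1 ≤ phi (F.cut {v}) G := by
  unfold phi
  apply Nat.succ_le_of_lt
  apply Submodule.finrank_lt_finrank_of_lt
  refine lt_of_le_of_ne (sup_le_sup (sub_cut_le F hv) le_rfl) ?_
  intro heq
  apply ind_not_mem F G hv ht hvt hno
  rw [heq]
  exact Submodule.mem_sup_left (ind_mem F hv)

end forests

section insts
variable {X : Type*} [DecidableEq X] [Fintype X] {m : ℕ}

/-- `I'` is obtained from `I` by cuts of edges. -/
structure Ok (I I' : Inst X m) : Prop where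
  mono : ∀ i, sub (I.F i) ≤ sub (I'.F i)
  tot : I'.k + (I'.ordMax : ℤ) ≤ I.k + (I.ordMax : ℤ)
  kle : I'.k ≤ I.k

theorem Ok.refl (I : Inst X m) : Ok I I := ⟨fun _ => le_rfl, le_rfl, le_rfl⟩

theorem Ok.trans {I J K : Inst X m} (h : Ok I J) (h' : Ok J K) : Ok I K :=
  ⟨fun i => (h.mono i).trans (h'.mono i), h'.tot.trans h.tot, h'.kle.trans h.kle⟩

theorem ord_le_ordMax (I : Inst X m) (i : Fin m) : (I.F i).ord ≤ I.ordMax :=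
  Finset.le_sup (f := fun i => (I.F i).ord) (Finset.mem_univ i)

theorem ok_cut (I : Inst X m) (j : Fin m) {v t : Finset X} (hv : v ∈ (I.F j).clusters)
    (ht : t ∈ (I.F j).clusters) (hvt : v ⊂ t) :
    Ok I ⟨Function.update I.F j ((I.F j).cut {v}), cutk I j⟩ := by
  have hle := ord_cut_le (I.F j) hv ht hvt
  refine ⟨?_, ?_, ?_⟩
  · intro i
    by_cases hij : i = j
    · subst hij
      simpa using sub_cut_le (I.F i) hv
    · simp [Function.update_of_ne hij]
  · have key : (Inst.ordMax (⟨Function.update I.F j ((I.F j).cut {v}), cutk I j⟩ : Inst X m)) ≤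
        if (I.F j).ord = I.ordMax then I.ordMax + 1 else I.ordMax := by
      refine Finset.sup_le ?_
      intro i _
      have h1 := ord_le_ordMax I i
      by_cases hij : i = j
      · subst hij
        simp only [Function.update_self]
        split_ifs <;> omega
      · simp only [Function.update_of_ne hij]
        split_ifs <;> omega
    show cutk I j + _ ≤ _
    unfold cutk at key ⊢
    split_ifs at key ⊢ with h
    · push_cast [← Int.ofNat_le] at key; linarith
    · rw [← Int.ofNat_le] at key; linarith
  · show cutk I j ≤ _
    unfold cutk
    split_ifs <;> omega

theorem ok_step {I I' : Inst X m} (h : RR1Step I I') : Ok I I' := by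
  obtain ⟨i, j, -, v, ⟨_, _, _, C, _, hv, _, ⟨t, ht, hvt⟩, _⟩, rfl⟩ := h
  exact ok_cut I j hv ht hvt

theorem ok_exhaust {I I' : Inst X m} (h : RR1Exhaust I I') : Ok I I' := by
  obtain ⟨h, -⟩ := h
  induction h with
  | refl => exact Ok.refl I
  | tail _ hs ih => exact ih.trans (ok_step hs)

theorem ok_branch {I : Inst X m} {p q i j : Fin m} {c v : Finset X}
    (hij : (i = p ∧ j = q) ∨ (i = q ∧ j = p)) (hne : i ≠ j)
    (hno : ¬ RR1Applicable I) (hc : (I.F j).IsChild c v) :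
    Ok I ⟨Function.update I.F j ((I.F j).cut {c}), cutk I j⟩ ∧
    phi (I.F p) (I.F q) + 1 ≤
      phi (Function.update I.F j ((I.F j).cut {c}) p)
        (Function.update I.F j ((I.F j).cut {c}) q) := by
  obtain ⟨h1, h2, h3, -⟩ := hc
  refine ⟨ok_cut I j h1 h2 h3, ?_⟩
  have hn : ¬ RR1App (I.F i) (I.F j) c := fun h => hno ⟨i, j, hne, c, h⟩
  have := phi_cut (I.F j) (I.F i) h1 h2 h3 hn
  rcases hij with ⟨rfl, rfl⟩ | ⟨rfl, rfl⟩
  · rw [Function.update_self, Function.update_of_ne hne, phi_comm, phi_comm (I.F i)]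
    exact this
  · rw [Function.update_self, Function.update_of_ne hne]
    exact this

theorem tree_ok {p q : Fin m} {I : Inst X m} {L : List (Inst X m × ℕ)}
    (h : TwoBRTree p q I L) : ¬ RR1Applicable I →
    ∀ x ∈ L, Ok I x.1 ∧ ¬ RR1Applicable x.1 ∧ LabelIso (x.1.F p) (x.1.F q) ∧
      phi (I.F p) (I.F q) + x.2 ≤ phi (x.1.F p) (x.1.F q) := by
  induction h with
  | done I h =>
    intro hno x hx
    rw [List.mem_singleton] at hx
    subst hx
    exact ⟨Ok.refl _, hno, h, le_rfl⟩
  | @step I I₁ I₂ K₁ K₂ L₁ L₂ i j v c₁ c₂ hij hbr he₁ he₂ h₁ h₂ ih₁ ih₂ =>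
    intro hno x hx
    obtain ⟨hne, ⟨C, -, hc₁, hc₂, -⟩, rfl, rfl⟩ := hbr
    obtain ⟨y, hy, rfl⟩ := List.mem_map.mp hx
    rcases List.mem_append.mp hy with hy | hy
    · obtain ⟨a1, a2, a3, a4⟩ := ih₁ he₁.2 y hy
      obtain ⟨b1, b2⟩ := ok_branch hij hne hno hc₁
      have e := ok_exhaust he₁
      refine ⟨(b1.trans e).trans a1, a2, a3, ?_⟩
      have := phi_mono (e.mono p) (e.mono q)
      dsimp only at this ⊢
      omega
    · obtain ⟨a1, a2, a3, a4⟩ := ih₂ he₂.2 y hy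
      obtain ⟨b1, b2⟩ := ok_branch hij hne hno hc₂
      have e := ok_exhaust he₂
      refine ⟨(b1.trans e).trans a1, a2, a3, ?_⟩
      have := phi_mono (e.mono p) (e.mono q)
      dsimp only at this ⊢
      omega

theorem tree_k {s t : Fin m} {I : Inst X m} {L : List (Inst X m × ℕ)}
    (h : TwoBRTree s t I L) (hst : FirstSecond I s t) (hno : ¬ RR1Applicable I) :
    ∀ x ∈ L, ¬ RR1Applicable x.1 ∧ x.1.k ≤ I.k - x.2 := by
  intro x hx
  obtain ⟨a1, a2, a3, a4⟩ := tree_ok h hno x hx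
  refine ⟨a2, ?_⟩
  rw [phi_iso a3] at a4
  have h1 := ord_le_ordMax x.1 s
  have h2 := ord_le_phi (I.F s) (I.F t)
  have h3 : I.ordMax ≤ (I.F s).ord := Finset.sup_le fun i _ => hst.2.1 i
  have h4 := a1.tot
  omega

noncomputable def wt (L : List (Inst X m × ℕ)) : ℚ := (L.map fun x => (1 : ℚ) / 2 ^ x.2).sum

theorem wt_append (A B : List (Inst X m × ℕ)) : wt (A ++ B) = wt A + wt B := by
  simp [wt]

theorem wt_shift (L : List (Inst X m × ℕ)) (n : ℕ) :
    wt (L.map fun x => (x.1, x.2 + n)) = wt L / 2 ^ n := by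
  induction L with
  | nil => simp [wt]
  | cons a L ih =>
    simp only [wt, List.map_cons, List.sum_cons, add_div] at ih ⊢
    rw [ih, pow_add, div_div]

theorem wt_tree {p q : Fin m} {I : Inst X m} {L : List (Inst X m × ℕ)}
    (h : TwoBRTree p q I L) : wt L = 1 := by
  induction h with
  | done I h => simp [wt]
  | step _ _ _ _ _ _ ih₁ ih₂ =>
    rw [wt_shift, wt_append, ih₁, ih₂]; norm_num

theorem coll {J : Inst X m} (hJ : ¬ RR1Applicable J) {L : List (Inst X m × ℕ)}
    (h : Relation.ReflTransGen CollStep [(J, 0)] L) :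
    wt L = 1 ∧ ∀ x ∈ L, ¬ RR1Applicable x.1 ∧ x.1.k ≤ J.k - x.2 := by
  induction h with
  | refl => 
    refine ⟨by simp [wt], ?_⟩
    intro x hx
    rw [List.mem_singleton] at hx
    subst hx
    exact ⟨hJ, by simp⟩
  | tail _ hs ih =>
    obtain ⟨ihw, ihx⟩ := ih
    cases hs with
    | @step I n A B L s t hst hni h =>
      have hI := ihx (I, n) (by simp)
      constructor
      · rw [← ihw, wt_append, wt_append, wt_shift, wt_tree h, wt_append,
          show (I, n) :: B = [(I, n)] ++ B from rfl, wt_append]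
        simp [wt, add_assoc]
      · intro x hx
        rcases List.mem_append.mp hx with hx | hx
        · rcases List.mem_append.mp hx with hx | hx
          · exact ihx x (by simp [hx])
          · obtain ⟨y, hy, rfl⟩ := List.mem_map.mp hx
            obtain ⟨b1, b2⟩ := tree_k h hst hI.1 y hy
            refine ⟨b1, ?_⟩
            have := hI.2
            push_cast
            dsimp only at this ⊢
            omega
        · exact ihx x (by simp [hx])

theorem wt_count (L : List (Inst X m × ℕ)) (h : ℕ) (hmax : ∀ x ∈ L, x.2 ≤ h) :
    ∑ l ∈ Finset.range (h + 1), ((L.map Prod.snd).count l : ℚ) / 2 ^ l = wt L := by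
  induction L with
  | nil => simp [wt]
  | cons a L ih =>
    have ih := ih fun x hx => hmax x (List.mem_cons_of_mem _ hx)
    have ha := hmax a List.mem_cons_self
    simp only [wt, List.map_cons, List.sum_cons, List.count_cons] at ih ⊢
    rw [← ih]
    simp only [Nat.cast_add, add_div, Finset.sum_add_distrib]
    rw [add_comm]
    congr 1
    rw [Finset.sum_eq_single a.2]
    · simp
    · intro b _ hb
      simp [Ne.symm hb]
    · intro hh
      exact absurd (Finset.mem_range.mpr (by omega)) hh

end insts

end MBR

/-- Theorem 3.6.  Let `L` be the collection of instances
obtained by the m-BR-process on `I`, where each instance is recorded together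
with the number of edges removed by Branching Rule 1 on its computation path,
and let `h` be the maximum of these numbers.  If Branching Rule 1 is applied
at least once, then: (i) `k^p ≤ k - |S_B^p|` for every resulting instance;
(ii) `∑_{l} |C_l| / 2^l = 1`; and hence the unique positive root of the
characteristic polynomial `x^h - (|C_r|·x^{h-r} + … + |C_h|)` of the produced
recurrence is at most `2` (i.e. the process satisfies `T(k) ≤ 2·T(k-1)`). -/
theorem statement_5 {X : Type*} [DecidableEq X] [Fintype X] {m : ℕ}
    (I : Inst X m) (L : List (Inst X m × ℕ)) (h : ℕ)
    (htree : MBRTree I L)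
    (hbr : ∃ x ∈ L, 0 < x.2)
    (hmax : ∀ x ∈ L, x.2 ≤ h) (hex : ∃ x ∈ L, x.2 = h) :
    (∀ x ∈ L, x.1.k ≤ I.k - x.2) ∧
    (∑ l ∈ Finset.range (h + 1), ((L.map Prod.snd).count l : ℚ) / 2 ^ l = 1) ∧
    (∀ x : ℝ, 0 < x →
      x ^ h = ∑ l ∈ Finset.range (h + 1),
        ((L.map Prod.snd).count l : ℝ) * x ^ (h - l) →
      x ≤ 2) := by
  obtain ⟨J, hJ, hL, -⟩ := htree
  obtain ⟨hw, hk⟩ := MBR.coll hJ.2 hL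
  have hsum := MBR.wt_count L h hmax
  rw [hw] at hsum
  refine ⟨?_, hsum, ?_⟩
  · intro x hx
    have h1 := (hk x hx).2
    have h2 := (MBR.ok_exhaust hJ).kle
    omega
  · intro x hx hpoly
    by_contra hlt
    push Not at hlt
    have hh : 0 < h := by
      obtain ⟨y, hy, hy0⟩ := hbr
      exact lt_of_lt_of_le hy0 (hmax y hy)
    have hcnt : 0 < (L.map Prod.snd).count h := by
      rw [List.count_pos_iff]
      obtain ⟨y, hy, hyh⟩ := hex
      exact List.mem_map.mpr ⟨y, hy, hyh⟩
    have hsumR : ∑ l ∈ Finset.range (h + 1), ((L.map Prod.snd).count l : ℝ) / 2 ^ l = 1 := by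
      have := congrArg (fun r : ℚ => (r : ℝ)) hsum
      push_cast at this
      exact this
    have hlt2 : ∑ l ∈ Finset.range (h + 1), ((L.map Prod.snd).count l : ℝ) / x ^ l < 1 := by
      rw [← hsumR]
      refine Finset.sum_lt_sum ?_ ⟨h, Finset.mem_range.mpr (by omega), ?_⟩
      · intro l _
        gcongr
      · have : (0 : ℝ) < ((L.map Prod.snd).count h : ℝ) := by exact_mod_cast hcnt
        refine div_lt_div_of_pos_left this (by positivity) ?_
        exact pow_lt_pow_left₀ hlt (by norm_num) (by omega)
    have heq : x ^ h = x ^ h *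
        ∑ l ∈ Finset.range (h + 1), ((L.map Prod.snd).count l : ℝ) / x ^ l := by
      conv_lhs => rw [hpoly]
      rw [Finset.mul_sum]
      refine Finset.sum_congr rfl ?_
      intro l hl
      have hl' : l ≤ h := by have := Finset.mem_range.mp hl; omega
      rw [pow_sub₀ x hx.ne' hl']
      field_simp
    have hp : 0 < x ^ h := pow_pos hx h
    nlinarith
end

section
/- For the m-BR-process on an instance (F_1,…,F_m;k) of the hMaf problem satisfying the 2-edge distance property, if Branching Rule 1 is applied during the process, then the m-BR-process satisfies the recurrence relation T(k) ≤ |C_r|·T(k−r−1) + … + |C_h|·T(k−h−1), where C_l is the set of resulting instances for which exactly l edges were removed by Branching Rule 1, r and h are the minimum and maximum such l, and Σ_{l=r}^{h} |C_l|/2^l = 1; in particular each resulting instance with l Branching-Rule-1 edges removed has parameter at most k − l − 1. -/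
/-!
A formalization framework for the Maximum Agreement Forest problem on multiple
rooted multifurcating phylogenetic trees.

An `X`-forest is modeled (up to forced contraction and label-preserving
isomorphism) by the laminar family of the label-sets `L(v)` of its vertices:
every vertex `v` is identified with the set `L(v)` of labels at its leaf
descendants, components correspond to the maximal clusters, leaves to the
singleton clusters, and the edge between a non-root vertex `v` and its parent
is identified with the cluster `L(v)`.
-/

open Finset

section Helpers

open scoped Classical

namespace XForest

variable {X : Type*} [DecidableEq X] [Fintype X]

lemma mem_components {F : XForest X} {s : Finset X} :
    s ∈ F.components ↔ s ∈ F.clusters ∧ ∀ t ∈ F.clusters, ¬s ⊂ t := by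
  unfold components
  exact Finset.mem_filter

lemma exists_comp (F : XForest X) (x : X) : ∃ C ∈ F.components, x ∈ C := by
  have hne : (F.clusters.filter fun s => x ∈ s).Nonempty :=
    ⟨{x}, Finset.mem_filter.mpr ⟨F.singleton_mem x, Finset.mem_singleton_self x⟩⟩
  obtain ⟨C, hC, hmax⟩ := Finset.exists_max_image _ Finset.card hne
  rw [Finset.mem_filter] at hC
  refine ⟨C, mem_components.mpr ⟨hC.1, fun t ht hss => ?_⟩, hC.2⟩
  have := hmax t (Finset.mem_filter.mpr ⟨ht, hss.1 hC.2⟩)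
  have := Finset.card_lt_card hss
  omega

lemma sub_comp {F : XForest X} {C s : Finset X} (hC : C ∈ F.components)
    (hs : s ∈ F.clusters) {x : X} (hx : x ∈ C) (hxs : x ∈ s) : s ⊆ C := by
  rw [mem_components] at hC
  rcases F.laminar s hs C hC.1 (Finset.not_disjoint_iff.mpr ⟨x, hxs, hx⟩) with h | h
  · exact h
  · by_contra h'
    exact hC.2 s hs ⟨h, h'⟩

/-- the component containing `x` -/
noncomputable def blk (F : XForest X) (x : X) : Finset X := (F.exists_comp x).choose

lemma blk_mem (F : XForest X) (x : X) : F.blk x ∈ F.components :=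
  (F.exists_comp x).choose_spec.1

lemma self_mem_blk (F : XForest X) (x : X) : x ∈ F.blk x :=
  (F.exists_comp x).choose_spec.2

lemma eq_blk {F : XForest X} {C : Finset X} (hC : C ∈ F.components) {x : X} (hx : x ∈ C) :
    C = F.blk x := by
  apply Finset.Subset.antisymm
  · exact sub_comp (F.blk_mem x) (mem_components.mp hC).1 (F.self_mem_blk x) hx
  · exact sub_comp hC (mem_components.mp (F.blk_mem x)).1 hx (F.self_mem_blk x)

/-- the partition into components -/
noncomputable def rel (F : XForest X) : Setoid X := Setoid.ker F.blk

lemma rel_iff {F : XForest X} {x y : X} : F.rel x y ↔ F.blk x = F.blk y := Iff.rfl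

lemma rel_iff_mem {F : XForest X} {x y : X} : F.rel x y ↔ y ∈ F.blk x := by
  rw [rel_iff]
  constructor
  · intro h; rw [h]; exact F.self_mem_blk y
  · intro h; exact eq_blk (F.blk_mem x) h

lemma components_eq (F : XForest X) : F.components = Finset.univ.image F.blk := by
  ext C
  rw [Finset.mem_image]
  constructor
  · intro hC
    obtain ⟨x, hx⟩ := F.nonempty_of_mem C (mem_components.mp hC).1
    exact ⟨x, Finset.mem_univ _, (eq_blk hC hx).symm⟩
  · rintro ⟨x, -, rfl⟩
    exact F.blk_mem x

/-- number of classes -/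
noncomputable def cnt (r : Setoid X) : ℕ := Nat.card (Quotient r)

lemma cnt_mono {r r' : Setoid X} (h : r ≤ r') : cnt r' ≤ cnt r := by
  unfold cnt
  refine Nat.card_le_card_of_surjective (Quotient.map' id (fun a b hab => h hab)) ?_
  intro q
  induction q using Quotient.inductionOn with
  | h a => exact ⟨Quotient.mk _ a, rfl⟩

lemma cnt_strict {r r' : Setoid X} (h : r ≤ r') (hne : r ≠ r') : cnt r' < cnt r := by
  refine lt_of_le_of_ne (cnt_mono h) fun heq => hne ?_
  have hs : Function.Surjective
      (Quotient.map' id (fun a b hab => h hab) : Quotient r → Quotient r') := by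
    intro q
    induction q using Quotient.inductionOn with
    | h a => exact ⟨Quotient.mk _ a, rfl⟩
  have hb := (Nat.bijective_iff_surjective_and_card _).mpr ⟨hs, heq.symm⟩
  refine le_antisymm h fun {a b} hab => ?_
  have : (Quotient.mk r a) = Quotient.mk r b := hb.1 (Quotient.sound hab)
  exact Quotient.exact this

lemma ord_eq (F : XForest X) : F.ord = cnt F.rel := by
  unfold ord cnt rel
  rw [components_eq, Nat.card_congr (Setoid.quotientKerEquivRange F.blk),
    ← Set.ncard_coe_finset, Finset.coe_image, Finset.coe_univ, Set.image_univ]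
  rfl

lemma components_eq_of_rel {F G : XForest X} (h : F.rel = G.rel) :
    F.components = G.components := by
  have : F.blk = G.blk := by
    funext x
    ext y
    rw [← rel_iff_mem, ← rel_iff_mem, h]
  rw [components_eq, components_eq, this]

lemma rel_eq_of_components {F G : XForest X} (h : F.components = G.components) :
    F.rel = G.rel := by
  have : F.blk = G.blk := by
    funext x
    exact eq_blk (h ▸ F.blk_mem x) (F.self_mem_blk x)
  unfold rel
  rw [this]

lemma ext_clusters {F G : XForest X} (h : F.clusters = G.clusters) : F = G := by
  cases F; cases G; cases h; rfl

lemma mem_cut {F : XForest X} {v s : Finset X} (hv : v ∈ F.clusters) :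
    s ∈ (F.cut {v}).clusters ↔
      s.Nonempty ∧ ∃ u ∈ F.clusters, s = if v ⊂ u then u \ v else u := by
  have key : ∀ u : Finset X, u \ ((({v} : Finset (Finset X)).filter
      fun d => d ∈ F.clusters).filter fun d => d ⊂ u).biUnion id
      = if v ⊂ u then u \ v else u := by
    intro u
    rw [Finset.filter_singleton, if_pos hv, Finset.filter_singleton]
    split_ifs <;> simp
  unfold cut cutFam
  simp only [Finset.mem_filter, Finset.mem_image, key]
  constructor
  · rintro ⟨⟨u, hu, rfl⟩, h⟩; exact ⟨h, u, hu, rfl⟩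
  · rintro ⟨h, u, hu, rfl⟩; exact ⟨⟨u, hu, rfl⟩, h⟩

lemma cut_empty (F : XForest X) : F.cut ∅ = F := by
  apply ext_clusters
  ext s
  unfold cut cutFam
  simp only [Finset.filter_empty, Finset.biUnion_empty, Finset.sdiff_empty, Finset.image_id',
    Finset.mem_filter]
  exact ⟨fun h => h.1, fun h => ⟨h, F.nonempty_of_mem s h⟩⟩

lemma blk_cut_in {F : XForest X} {v : Finset X} (hv : v ∈ F.clusters) {x : X} (hx : x ∈ v) :
    (F.cut {v}).blk x = v := by
  refine (eq_blk (mem_components.mpr ⟨?_, ?_⟩) hx).symm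
  · rw [mem_cut hv]
    exact ⟨⟨x, hx⟩, v, hv, by simp⟩
  · intro t ht hss
    rw [mem_cut hv] at ht
    obtain ⟨-, u, hu, rfl⟩ := ht
    split_ifs at hss with h
    · exact (Finset.mem_sdiff.mp (hss.1 hx)).2 hx
    · exact h hss

lemma blk_cut_out {F : XForest X} {v : Finset X} (hv : v ∈ F.clusters) {x : X} (hx : x ∉ v) :
    (F.cut {v}).blk x = F.blk x \ v := by
  have hxB := F.self_mem_blk x
  have hB := mem_components.mp (F.blk_mem x)
  refine (eq_blk (mem_components.mpr ⟨?_, ?_⟩) (Finset.mem_sdiff.mpr ⟨hxB, hx⟩)).symm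
  · rw [mem_cut hv]
    refine ⟨⟨x, Finset.mem_sdiff.mpr ⟨hxB, hx⟩⟩, F.blk x, hB.1, ?_⟩
    split_ifs with h
    · rfl
    · rw [Finset.sdiff_eq_self_iff_disjoint]
      by_contra hd
      obtain ⟨z, hz1, hz2⟩ := Finset.not_disjoint_iff.mp hd
      have hs := sub_comp (F.blk_mem x) hv hz1 hz2
      exact h ⟨hs, fun h' => hx (h' hxB)⟩
  · intro t ht hss
    rw [mem_cut hv] at ht
    obtain ⟨-, u, hu, rfl⟩ := ht
    obtain ⟨z, hzu, hzn⟩ := Finset.exists_of_ssubset hss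
    have hxu := hss.1 (Finset.mem_sdiff.mpr ⟨hxB, hx⟩)
    split_ifs at hzu hxu with h
    · rw [Finset.mem_sdiff] at hzu hxu
      exact hzn (Finset.mem_sdiff.mpr
        ⟨sub_comp (F.blk_mem x) hu hxB hxu.1 hzu.1, hzu.2⟩)
    · have hzB := sub_comp (F.blk_mem x) hu hxB hxu hzu
      have hzv : z ∈ v := by
        by_contra h'
        exact hzn (Finset.mem_sdiff.mpr ⟨hzB, h'⟩)
      rcases F.laminar v hv u hu (Finset.not_disjoint_iff.mpr ⟨z, hzv, hzu⟩) with h1 | h1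
      · exact h ⟨h1, fun h2 => hx (h2 hxu)⟩
      · exact hx (h1 hxu)

lemma rel_cut_le {F : XForest X} {v : Finset X} (hv : v ∈ F.clusters) :
    (F.cut {v}).rel ≤ F.rel := by
  intro x y hxy
  rw [rel_iff_mem] at hxy ⊢
  by_cases hx : x ∈ v
  · rw [blk_cut_in hv hx] at hxy
    exact sub_comp (F.blk_mem x) hv (F.self_mem_blk x) hx hxy
  · rw [blk_cut_out hv hx] at hxy
    exact (Finset.mem_sdiff.mp hxy).1

lemma not_rel_cut {F : XForest X} {v : Finset X} (hv : v ∈ F.clusters) {x y : X}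
    (hx : x ∈ v) (hy : y ∉ v) : ¬ (F.cut {v}).rel x y := by
  rw [rel_iff_mem, blk_cut_in hv hx]
  exact hy

lemma ord_cut_le {F : XForest X} {v : Finset X} (hv : v ∈ F.clusters) :
    (F.cut {v}).ord ≤ F.ord + 1 := by
  have : (F.cut {v}).components ⊆ insert v (F.components.image fun D => D \ v) := by
    rw [components_eq (F.cut {v})]
    intro C hC
    obtain ⟨x, -, rfl⟩ := Finset.mem_image.mp hC
    by_cases hx : x ∈ v
    · rw [blk_cut_in hv hx]; exact Finset.mem_insert_self _ _
    · rw [blk_cut_out hv hx]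
      exact Finset.mem_insert_of_mem (Finset.mem_image.mpr ⟨_, F.blk_mem x, rfl⟩)
  unfold ord
  calc _ ≤ _ := Finset.card_le_card this
    _ ≤ _ := Finset.card_insert_le _ _
    _ ≤ _ := Nat.add_le_add_right Finset.card_image_le 1

lemma lt_ord_cut {F : XForest X} {v : Finset X} (hv : v ∈ F.clusters)
    (ht : ∃ t ∈ F.clusters, v ⊂ t) : F.ord < (F.cut {v}).ord := by
  rw [ord_eq, ord_eq]
  refine cnt_strict (rel_cut_le hv) fun heq => ?_
  obtain ⟨t, ht, hvt⟩ := ht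
  obtain ⟨x, hx⟩ := F.nonempty_of_mem v hv
  obtain ⟨y, hyt, hyv⟩ := Finset.exists_of_ssubset hvt
  apply not_rel_cut hv hx hyv
  rw [heq, rel_iff_mem]
  exact sub_comp (F.blk_mem x) ht (F.self_mem_blk x) (hvt.1 hx) hyt

end XForest

open XForest

variable {X : Type*} [DecidableEq X] [Fintype X] {m : ℕ}

lemma meet_strict {Fi Fj : XForest X} {c : Finset X} (hc : c ∈ Fj.clusters)
    (ht : ∃ t ∈ Fj.clusters, c ⊂ t) (hn : ¬RR1App Fi Fj c) :
    cnt (Fi.rel ⊓ Fj.rel) < cnt (Fi.rel ⊓ (Fj.cut {c}).rel) := by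
  have hle : Fi.rel ⊓ (Fj.cut {c}).rel ≤ Fi.rel ⊓ Fj.rel :=
    inf_le_inf_left _ (rel_cut_le hc)
  refine cnt_strict hle fun heq => hn ?_
  obtain ⟨x, hx⟩ := Fj.nonempty_of_mem c hc
  have hcB := sub_comp (Fj.blk_mem x) hc (Fj.self_mem_blk x) hx
  refine ⟨c.image Fi.blk, ?_, ⟨Fi.blk x, Finset.mem_image_of_mem _ hx⟩, Fj.blk x, Fj.blk_mem x,
    hc, hcB, ht, ?_⟩
  · intro C hC
    obtain ⟨z, -, rfl⟩ := Finset.mem_image.mp hC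
    exact Fi.blk_mem z
  · ext y
    simp only [Finset.mem_inter, Finset.mem_biUnion, Finset.mem_image, id]
    constructor
    · intro hy
      exact ⟨hcB hy, _, ⟨y, hy, rfl⟩, Fi.self_mem_blk y⟩
    · rintro ⟨hyB, _, ⟨z, hz, rfl⟩, hyz⟩
      by_contra hyc
      have h1 : Fi.rel z y := rel_iff_mem.mpr hyz
      have h2 : Fj.rel z y :=
        Fj.rel.trans' (Fj.rel.symm' (rel_iff_mem.mpr (hcB hz))) (rel_iff_mem.mpr hyB)
      have h3 : (Fi.rel ⊓ Fj.rel) z y := ⟨h1, h2⟩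
      rw [← heq] at h3
      exact not_rel_cut hc hz hyc h3.2

lemma ord_le_ordMax (I : Inst X m) (i : Fin m) : (I.F i).ord ≤ I.ordMax :=
  Finset.le_sup (f := fun i => (I.F i).ord) (Finset.mem_univ i)

/-- refinement of instances with the total budget not increasing -/
def Refines (I I' : Inst X m) : Prop :=
  (∀ i, (I'.F i).rel ≤ (I.F i).rel) ∧ I'.k + I'.ordMax ≤ I.k + I.ordMax

lemma Refines.refl (I : Inst X m) : Refines I I := ⟨fun _ => le_rfl, le_rfl⟩

lemma Refines.trans {I J K : Inst X m} (h : Refines I J) (h' : Refines J K) : Refines I K :=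
  ⟨fun i => (h'.1 i).trans (h.1 i), h'.2.trans h.2⟩

lemma refines_cut (I : Inst X m) (j : Fin m) {v : Finset X} (hv : v ∈ (I.F j).clusters) :
    Refines I ⟨Function.update I.F j ((I.F j).cut {v}), cutk I j⟩ := by
  constructor
  · intro i
    by_cases h : i = j
    · subst h
      simpa using rel_cut_le hv
    · simp [Function.update_of_ne h]
  · have h1 := ord_cut_le hv
    have h2 := ord_le_ordMax I j
    have hb : ∀ B : ℕ, I.ordMax ≤ B → (I.F j).ord + 1 ≤ B →
        (Inst.mk (Function.update I.F j ((I.F j).cut {v})) (cutk I j)).ordMax ≤ B := by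
      intro B hB hB'
      refine Finset.sup_le fun i _ => ?_
      by_cases h : i = j
      · subst h
        simpa using h1.trans hB'
      · simpa [Function.update_of_ne h] using (ord_le_ordMax I i).trans hB
    unfold cutk at hb ⊢
    split_ifs at hb ⊢ with h
    · have := hb (I.ordMax + 1) (by omega) (by omega)
      dsimp only
      omega
    · have := hb I.ordMax le_rfl (by omega)
      dsimp only
      omega

lemma refines_exhaust {I J : Inst X m} (h : RR1Exhaust I J) : Refines I J := by
  obtain ⟨h, -⟩ := h
  induction h with
  | refl => exact Refines.refl _
  | tail _ hs ih =>
    refine ih.trans ?_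
    obtain ⟨i, j, -, v, ⟨_, _, _, C, _, hv, _⟩, rfl⟩ := hs
    exact refines_cut _ j hv

/-- number of classes of the common refinement of two forests -/
noncomputable def mc (I : Inst X m) (p q : Fin m) : ℕ := cnt ((I.F p).rel ⊓ (I.F q).rel)

lemma mc_comm (I : Inst X m) (p q : Fin m) : mc I p q = mc I q p := by
  unfold mc; rw [inf_comm]

lemma mc_mono {I J : Inst X m} (h : Refines I J) (p q : Fin m) : mc I p q ≤ mc J p q :=
  cnt_mono (inf_le_inf (h.1 p) (h.1 q))

lemma mc_step {I : Inst X m} (hI : ¬RR1Applicable I) {i j : Fin m} (hij : i ≠ j)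
    {v c : Finset X} (hc : (I.F j).IsChild c v) {K : Inst X m}
    (hK : RR1Exhaust ⟨Function.update I.F j ((I.F j).cut {c}), cutk I j⟩ K) :
    Refines I K ∧ mc I i j + 1 ≤ mc K i j := by
  refine ⟨(refines_cut I j hc.1).trans (refines_exhaust hK), ?_⟩
  refine le_trans ?_ (mc_mono (refines_exhaust hK) i j)
  have := meet_strict (Fi := I.F i) hc.1 ⟨v, hc.2.1, hc.2.2.1⟩
    (fun h => hI ⟨i, j, hij, c, h⟩)
  unfold mc
  simpa [Function.update_of_ne hij] using this

lemma tree_inv {p q : Fin m} {I : Inst X m} {L : List (Inst X m × ℕ)}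
    (h : TwoBRTree p q I L) : ¬RR1Applicable I →
    ∀ x ∈ L, ¬RR1Applicable x.1 ∧ Refines I x.1 ∧ mc I p q + x.2 ≤ x.1.ordMax := by
  induction h with
  | done I h =>
    intro hI x hx
    rw [List.mem_singleton] at hx
    subst hx
    refine ⟨hI, Refines.refl _, ?_⟩
    have : mc I p q = (I.F p).ord := by
      unfold mc
      rw [rel_eq_of_components h, inf_idem, ord_eq, rel_eq_of_components h]
    rw [this]
    exact ord_le_ordMax I p
  | @step I I₁ I₂ K₁ K₂ L₁ L₂ i j v c₁ c₂ hij hbr he₁ he₂ h₁ h₂ ih₁ ih₂ =>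
    intro hI x hx
    obtain ⟨hne, ⟨C, -, hc₁, hc₂, -⟩, rfl, rfl⟩ := hbr
    obtain ⟨y, hy, rfl⟩ := List.mem_map.mp hx
    have s₁ := mc_step hI hne hc₁ he₁
    have s₂ := mc_step hI hne hc₂ he₂
    have hm : ∀ K : Inst X m, mc I i j + 1 ≤ mc K i j → mc I p q + 1 ≤ mc K p q := by
      intro K hK
      rcases hij with ⟨rfl, rfl⟩ | ⟨rfl, rfl⟩
      · exact hK
      · rwa [mc_comm I, mc_comm K]
    rcases List.mem_append.mp hy with hy | hy
    · obtain ⟨a, b, c⟩ := ih₁ he₁.2 y hy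
      refine ⟨a, s₁.1.trans b, ?_⟩
      have := hm _ s₁.2
      dsimp only
      omega
    · obtain ⟨a, b, c⟩ := ih₂ he₂.2 y hy
      refine ⟨a, s₂.1.trans b, ?_⟩
      have := hm _ s₂.2
      dsimp only
      omega

/-- Kraft sum -/
def kraft (L : List (Inst X m × ℕ)) : ℚ := (L.map fun x => (1 : ℚ) / 2 ^ x.2).sum

lemma kraft_append (A B : List (Inst X m × ℕ)) : kraft (A ++ B) = kraft A + kraft B := by
  simp [kraft]

lemma kraft_cons (x : Inst X m × ℕ) (B : List (Inst X m × ℕ)) :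
    kraft (x :: B) = 1 / 2 ^ x.2 + kraft B := by
  simp [kraft]

lemma kraft_shift (L : List (Inst X m × ℕ)) (n : ℕ) :
    kraft (L.map fun y => (y.1, y.2 + n)) = kraft L / 2 ^ n := by
  induction L with
  | nil => simp [kraft]
  | cons a L ih =>
    rw [List.map_cons, kraft_cons, kraft_cons, ih]
    field_simp
    ring

lemma kraft_tree {p q : Fin m} {I : Inst X m} {L : List (Inst X m × ℕ)}
    (h : TwoBRTree p q I L) : kraft L = 1 := by
  induction h with
  | done I h => simp [kraft]
  | step hij hbr he₁ he₂ h₁ h₂ ih₁ ih₂ =>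
    rw [kraft_shift, kraft_append, ih₁, ih₂]
    norm_num

lemma kraft_step {A B : List (Inst X m × ℕ)} (h : CollStep A B) : kraft B = kraft A := by
  cases h with
  | step hst hni h =>
    rw [kraft_append, kraft_append, kraft_shift, kraft_tree h, kraft_append, kraft_cons]
    ring

lemma kraft_eq (L : List (Inst X m × ℕ)) (h : ℕ) (hmax : ∀ x ∈ L, x.2 ≤ h) :
    ∑ l ∈ Finset.range (h + 1), ((L.map Prod.snd).count l : ℚ) / 2 ^ l = kraft L := by
  induction L with
  | nil => simp [kraft]
  | cons a L ih =>
    rw [kraft_cons, ← ih fun x hx => hmax x (List.mem_cons_of_mem _ hx)]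
    have ha := hmax a List.mem_cons_self
    simp only [List.map_cons, List.count_cons, Nat.cast_add, add_div, Finset.sum_add_distrib]
    rw [add_comm]
    congr 1
    rw [Finset.sum_eq_single a.2]
    · simp
    · intro b _ hb
      simp [hb.symm]
    · intro hn
      exact absurd (Finset.mem_range.mpr (by omega)) hn

/-- the invariant of the collection after the first 2-BR-process -/
def Good (K : ℤ) (O : ℕ) (x : Inst X m × ℕ) : Prop :=
  ¬RR1Applicable x.1 ∧ x.1.k + x.1.ordMax ≤ K ∧ O + 2 + x.2 ≤ x.1.ordMax

lemma good_tree {K : ℤ} {O n : ℕ} {I : Inst X m} {s t : Fin m} {L : List (Inst X m × ℕ)}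
    (h : TwoBRTree s t I L) (hI : ¬RR1Applicable I) (hK : I.k + I.ordMax ≤ K)
    (hm : O + 2 + n ≤ mc I s t) :
    ∀ x ∈ L.map (fun y => (y.1, y.2 + n)), Good K O x := by
  intro x hx
  obtain ⟨y, hy, rfl⟩ := List.mem_map.mp hx
  obtain ⟨a, b, c⟩ := tree_inv h hI y hy
  refine ⟨a, b.2.trans hK, ?_⟩
  dsimp only
  omega

lemma ord_le_mc (I : Inst X m) (s t : Fin m) : (I.F s).ord ≤ mc I s t := by
  rw [ord_eq]
  exact cnt_mono inf_le_left

lemma ordMax_le_first {I : Inst X m} {s t : Fin m} (h : FirstSecond I s t) :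
    I.ordMax ≤ (I.F s).ord := Finset.sup_le fun i _ => h.2.1 i

lemma good_step {K : ℤ} {O : ℕ} {A B : List (Inst X m × ℕ)} (h : CollStep A B)
    (hA : ∀ x ∈ A, Good K O x) : ∀ x ∈ B, Good K O x := by
  cases h with
  | @step I n A B L s t hst hni h =>
    obtain ⟨g1, g2, g3⟩ := hA (I, n) (by simp)
    have hL := good_tree (O := O) (n := n) h g1 g2
      (g3.trans ((ordMax_le_first hst).trans (ord_le_mc I s t)))
    intro x hx
    rcases List.mem_append.mp hx with hx | hx
    · rcases List.mem_append.mp hx with hx | hx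
      · exact hA x (by simp [hx])
      · exact hL x hx
    · exact hA x (by simp [hx])

lemma good_steps {K : ℤ} {O : ℕ} {A B : List (Inst X m × ℕ)}
    (h : Relation.ReflTransGen CollStep A B)
    (hA : ∀ x ∈ A, Good K O x) : ∀ x ∈ B, Good K O x := by
  induction h with
  | refl => exact hA
  | tail _ hs ih => exact good_step hs ih

lemma kraft_steps {A B : List (Inst X m × ℕ)}
    (h : Relation.ReflTransGen CollStep A B) : kraft B = kraft A := by
  induction h with
  | refl => rfl
  | tail _ hs ih => rw [kraft_step hs, ih]

lemma mc_start {I : Inst X m} {s t i j : Fin m} {O : ℕ} (hst : FirstSecond I s t)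
    (hni : ¬LabelIso (I.F s) (I.F t)) (hij : i ≠ j)
    (hi : O + 1 ≤ (I.F i).ord) (hj : O + 1 ≤ (I.F j).ord) : O + 2 ≤ mc I s t := by
  have hs : O + 1 ≤ (I.F s).ord := hi.trans (hst.2.1 i)
  have ht : O + 1 ≤ (I.F t).ord := by
    by_cases h : i = s
    · exact hj.trans (hst.2.2 j fun h' => hij (h.trans h'.symm))
    · exact hi.trans (hst.2.2 i h)
  rw [ord_eq] at hs ht
  by_cases h1 : (I.F s).rel ⊓ (I.F t).rel = (I.F s).rel
  · by_cases h2 : (I.F s).rel ⊓ (I.F t).rel = (I.F t).rel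
    · exact absurd (components_eq_of_rel (h1.symm.trans h2)) hni
    · have := cnt_strict inf_le_right h2
      unfold mc
      omega
  · have := cnt_strict inf_le_left h1
    unfold mc
    omega

lemma start_orders {I : Inst X m} (h : TwoEdgeDist I) :
    ∃ O : ℕ, I.ordMax ≤ O + 1 ∧
      ∃ i j : Fin m, i ≠ j ∧ O + 1 ≤ (I.F i).ord ∧ O + 1 ≤ (I.F j).ord := by
  obtain ⟨G, E, hiso, -, hsub, hcard, hroot, hF, i, j, hij, vi, hvi, vj, hvj, -⟩ := h
  have hO : ∀ a b, (G.F a).ord = (G.F b).ord := fun a b => by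
    unfold XForest.ord
    rw [hiso a b]
  have hsing : ∀ a, ∀ v ∈ E a, E a = {v} := fun a v hv =>
    Finset.eq_singleton_iff_unique_mem.mpr
      ⟨hv, fun w hw => Finset.card_le_one.mp (hcard a) w hw v hv⟩
  have hcut : ∀ a, ∀ v ∈ E a, I.F a = (G.F a).cut {v} := fun a v hv => by
    rw [← hsing a v hv]
    exact ext_clusters (hF a)
  have low : ∀ a, ∀ v ∈ E a, (G.F i).ord + 1 ≤ (I.F a).ord := fun a v hv => by
    rw [hcut a v hv, hO i a]
    exact lt_ord_cut (hsub a hv) (hroot a v hv)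
  refine ⟨(G.F i).ord, Finset.sup_le fun a _ => ?_, i, j, hij.ne, low i vi hvi, low j vj hvj⟩
  rw [hO i a]
  rcases (E a).eq_empty_or_nonempty with he | ⟨v, hv⟩
  · have : I.F a = G.F a := by
      rw [← cut_empty (G.F a), ← he]
      exact ext_clusters (hF a)
    rw [this]
    omega
  · rw [hcut a v hv]
    exact ord_cut_le (hsub a hv)

end Helpers

/-- Theorem 3.11.  For the m-BR-process on an instance of the
hMaf problem satisfying the 2-edge distance property during which Branching
Rule 1 is applied, it satisfies the recurrence
`T(k) ≤ |C_r|·T(k-r-1) + … + |C_h|·T(k-h-1)`: each resulting instance with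
`l` Branching-Rule-1 edges removed has parameter at most `k - l - 1`, and
`∑_{l} |C_l| / 2^l = 1`. -/
theorem statement_7 {X : Type*} [DecidableEq X] [Fintype X] {m : ℕ}
    (I : Inst X m) (L : List (Inst X m × ℕ)) (h : ℕ)
    (h2e : TwoEdgeDist I)
    (htree : MBRTree I L)
    (hbr : ∃ x ∈ L, 0 < x.2)
    (hmax : ∀ x ∈ L, x.2 ≤ h) (hex : ∃ x ∈ L, x.2 = h) :
    (∀ x ∈ L, x.1.k ≤ I.k - x.2 - 1) ∧
    (∑ l ∈ Finset.range (h + 1), ((L.map Prod.snd).count l : ℚ) / 2 ^ l = 1) := by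
  obtain ⟨J, hJ, hsteps, -⟩ := htree
  constructor
  · obtain ⟨O, hO, i, j, hij, hi, hj⟩ := start_orders h2e
    have hJr := refines_exhaust hJ
    have hup : ∀ a, (I.F a).ord ≤ (J.F a).ord := fun a => by
      rw [XForest.ord_eq, XForest.ord_eq]
      exact XForest.cnt_mono (hJr.1 a)
    have hgood : ∀ x ∈ L, Good (I.k + I.ordMax) O x := by
      rcases Relation.ReflTransGen.cases_head hsteps with heq | ⟨M, hM, hrest⟩
      · obtain ⟨x, hx, hpos⟩ := hbr
        rw [← heq, List.mem_singleton] at hx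
        subst hx
        exact absurd hpos (lt_irrefl _)
      · refine good_steps hrest ?_
        generalize hS : [(J, 0)] = S at hM
        cases hM with
        | @step I' n A B L' s t hst hni h =>
          have hA : A = [] := by
            cases A with
            | nil => rfl
            | cons a A => simp at hS
          subst hA
          simp only [List.nil_append, List.cons.injEq, Prod.mk.injEq] at hS
          obtain ⟨⟨rfl, rfl⟩, rfl⟩ := hS
          rw [List.nil_append, List.append_nil]
          exact good_tree h hJ.2 hJr.2
            (mc_start hst hni hij (hi.trans (hup i)) (hj.trans (hup j)))
    intro x hx
    obtain ⟨-, g2, g3⟩ := hgood x hx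
    omega
  · rw [kraft_eq L h hmax, kraft_steps hsteps]
    simp [kraft]
end

section
/- For any instance (F_1,…,F_m;k) of the Maf problem (hard or soft) that satisfies the label-set isomorphism property, if some F_i has no maximal sibling-set, then all the X-forests F_1,…,F_m are isomorphic and F_i is the unique maximum agreement forest for the X-forests in the instance. -/
/-!
A formalization framework for the Maximum Agreement Forest problem on multiple
rooted multifurcating phylogenetic trees.

An `X`-forest is modeled (up to forced contraction and label-preserving
isomorphism) by the laminar family of the label-sets `L(v)` of its vertices:
every vertex `v` is identified with the set `L(v)` of labels at its leaf
descendants, components correspond to the maximal clusters, leaves to the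
singleton clusters, and the edge between a non-root vertex `v` and its parent
is identified with the cluster `L(v)`.
-/

open Finset

namespace XForest

/-- All vertices of the forest are isolated leaves. -/
def Single {X : Type*} (F : XForest X) : Prop := ∀ s ∈ F.clusters, s.card = 1

theorem Single.eq {X : Type*} {F G : XForest X} (hF : F.Single) (hG : G.Single) :
    F.clusters = G.clusters := by
  ext s
  constructor
  · intro h
    obtain ⟨x, rfl⟩ := Finset.card_eq_one.mp (hF s h)
    exact G.singleton_mem x
  · intro h
    obtain ⟨x, rfl⟩ := Finset.card_eq_one.mp (hG s h)
    exact F.singleton_mem x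

variable {X : Type*} [DecidableEq X] [Fintype X]

theorem ord_congr {F G : XForest X} (h : F.clusters = G.clusters) : F.ord = G.ord := by
  unfold ord components
  rw [h]

theorem exists_component (F : XForest X) {s : Finset X} (hs : s ∈ F.clusters) :
    ∃ C ∈ F.components, s ⊆ C := by
  obtain ⟨C, hsC, hC⟩ := F.clusters.exists_le_maximal hs
  refine ⟨C, Finset.mem_filter.mpr ⟨hC.prop, ?_⟩, hsC⟩
  intro t ht hlt
  exact hlt.2 (hC.le_of_ge ht hlt.1)

theorem single_of_components {F G : XForest X} (hF : F.Single)
    (h : G.components = F.components) : G.Single := by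
  intro s hs
  obtain ⟨C, hC, hsC⟩ := G.exists_component hs
  rw [h] at hC
  have h1 := hF C (Finset.mem_filter.mp hC).1
  have h2 := Finset.card_le_card hsC
  have h3 := (G.nonempty_of_mem s hs).card_pos
  omega

theorem single_of_noMSS (F : XForest X) (h : ∀ S, ¬F.IsMSS S) : F.Single := by
  intro s
  induction s using Finset.strongInduction with
  | H s ih =>
    intro hs
    have h3 := (F.nonempty_of_mem s hs).card_pos
    by_contra hne
    exact h s ⟨hs, by omega, fun c hc hcs => ih c hcs hc⟩

theorem single_of_subforest {F G : XForest X} (hF : F.Single)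
    (h : IsSubforest G F) : G.Single := by
  obtain ⟨D, -, hG⟩ := h
  intro s hs
  have h3 := (G.nonempty_of_mem s hs).card_pos
  rw [hG] at hs
  obtain ⟨t, ht, rfl⟩ := Finset.mem_image.mp (Finset.mem_filter.mp hs).1
  have h1 := hF t ht
  have h2 := Finset.card_le_card (Finset.sdiff_subset
    (s := t) (t := ((D.filter fun d => d ∈ F.clusters).filter fun d => d ⊂ t).biUnion id))
  omega

theorem Single.isSubforest {F G : XForest X} (hF : F.Single) (hG : G.Single) :
    IsSubforest G F :=
  ⟨∅, Finset.empty_subset _, hG.eq (single_of_subforest hF ⟨∅, Finset.empty_subset _, rfl⟩)⟩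

theorem Single.isBinary {F : XForest X} (hF : F.Single) : F.IsBinary := by
  intro s hs h2
  have := hF s hs
  omega

end XForest

/-- Lemma 4.2.  For any instance of the Maf problem (hard or
soft) satisfying the label-set isomorphism property, if some `F_i` has no
maximal sibling-set, then all the forests in the instance are isomorphic and
`F_i` is the unique maximum agreement forest (hard and soft) for them. -/
theorem statement_9 {X : Type*} [DecidableEq X] [Fintype X] {m : ℕ}
    (I : Inst X m) (i : Fin m)
    (hiso : InstLabelIso I)
    (hno : ∀ S : Finset X, ¬(I.F i).IsMSS S) :
    (∀ j, (I.F j).clusters = (I.F i).clusters) ∧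
    (IsHMAF I.F (I.F i) ∧
      ∀ G : XForest X, IsHMAF I.F G → G.clusters = (I.F i).clusters) ∧
    (IsSMAF I.F (I.F i) ∧
      ∀ G : XForest X, IsSMAF I.F G → G.clusters = (I.F i).clusters) := by
  have hi := (I.F i).single_of_noMSS hno
  have hs : ∀ j, (I.F j).Single := fun j => XForest.single_of_components hi (hiso j i)
  have hH : ∀ G, IsHAF I.F G → G.Single := fun G h => XForest.single_of_subforest hi (h i)
  have hS : ∀ G, IsSAF I.F G → G.Single := by
    intro G h
    obtain ⟨-, B, -, hB, hG⟩ := h i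
    exact XForest.single_of_subforest (XForest.single_of_components hi hB.2) hG
  refine ⟨fun j => (hs j).eq hi, ⟨⟨fun j => (hs j).isSubforest hi, ?_⟩, ?_⟩, ⟨⟨?_, ?_⟩, ?_⟩⟩
  · exact fun G h => (XForest.ord_congr (hi.eq (hH G h))).le
  · exact fun G h => (hH G h.1).eq hi
  · exact fun j => ⟨hi.isBinary, I.F j, (hs j).isBinary, ⟨Finset.Subset.refl _, rfl⟩,
      (hs j).isSubforest hi⟩
  · exact fun G h => (XForest.ord_congr (hi.eq (hS G h))).le
  · exact fun G h => (hS G h.1).eq hi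
end
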